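/- arXiv:1911.07017 — 9 statements merged into one kernel-verified Lean document; each statement's English description precedes it below -/
import Mathlib

section
/- Let η ∈ (0,1) and set ρ*(η) = −1/ln η − η/(1−η). Then for every ρ ∈ [0,1] one has χ_L(ρ,η) ≤ χ_L(ρ*(η),η); that is, ρ*(η) is a global maximizer of the map ρ ↦ χ_L(ρ,η) on [0,1]. -/
/-- The low-SNR sparsity metric χ_L(ρ,η) = η^(ρ−1)·(η + (1−η)·ρ). -/
noncomputable def chiL (ρ η : ℝ) : ℝ := η ^ (ρ - 1) * (η + (1 - η) * ρ)

theorem chiL_le_at_rhoStar (η : ℝ) (hη : η ∈ Set.Ioo (0 : ℝ) 1)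
    (ρstar : ℝ) (hρstar : ρstar = -1 / Real.log η - η / (1 - η)) :
    ∀ ρ ∈ Set.Icc (0 : ℝ) 1, chiL ρ η ≤ chiL ρstar η := by
  obtain ⟨h0, h1⟩ := hη
  intro ρ _
  have hlog : Real.log η < 0 := Real.log_neg h0 h1
  have hne : Real.log η ≠ 0 := hlog.ne
  have h1' : (1 - η) ≠ 0 := by linarith
  have hs : η + (1 - η) * ρstar = (1 - η) / (-Real.log η) := by
    rw [hρstar]
    field_simp
    ring
  have hr : η + (1 - η) * ρ =
      (1 - η) / (-Real.log η) * (1 + -Real.log η * (ρ - ρstar)) := by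
    have : η + (1 - η) * ρ = (η + (1 - η) * ρstar) + (1 - η) * (ρ - ρstar) := by ring
    rw [this, hs]
    field_simp
    ring
  have hpow : η ^ (ρstar - 1) = η ^ (ρ - 1) * Real.exp (-Real.log η * (ρ - ρstar)) := by
    rw [Real.rpow_def_of_pos h0, Real.rpow_def_of_pos h0, ← Real.exp_add]
    congr 1
    ring
  have hexp := Real.add_one_le_exp (-Real.log η * (ρ - ρstar))
  have hc : 0 ≤ (1 - η) / (-Real.log η) := div_nonneg (by linarith) (by linarith)
  have hp : 0 ≤ η ^ (ρ - 1) := Real.rpow_nonneg h0.le _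
  unfold chiL
  rw [hs, hr, hpow]
  have := mul_le_mul_of_nonneg_left hexp (mul_nonneg hp hc)
  linarith
end

section
/- Let η ∈ (0,1) and set ρ*(η) = −1/ln η − η/(1−η) (which satisfies 0 < ρ*(η) < 1/2). Then the map ρ ↦ χ_L(ρ,η) is strictly increasing on the interval [0, ρ*(η)] and strictly decreasing on the interval [ρ*(η), 1]. -/
theorem chiL_strictMonoOn_strictAntiOn (η : ℝ) (hη : η ∈ Set.Ioo (0 : ℝ) 1)
    (ρstar : ℝ) (hρstar : ρstar = -1 / Real.log η - η / (1 - η)) :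
    (0 < ρstar ∧ ρstar < 1 / 2) ∧
    StrictMonoOn (fun ρ => chiL ρ η) (Set.Icc 0 ρstar) ∧
    StrictAntiOn (fun ρ => chiL ρ η) (Set.Icc ρstar 1) := by
  obtain ⟨h0, h1⟩ := hη
  have h1' : 0 < 1 - η := by linarith
  obtain ⟨L, hL⟩ : ∃ L, L = -Real.log η := ⟨_, rfl⟩
  have hlog : Real.log η = -L := by linarith
  have hL0 : 0 < L := by
    have := Real.log_neg h0 h1
    linarith
  have hLinv : Real.log (1 + (1 / η - 1)) = L := by
    rw [show 1 + (1 / η - 1) = η⁻¹ by ring, Real.log_inv, hL]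
  have hup : L < (1 - η) / η := by
    have h := Real.log_lt_sub_one_of_pos (inv_pos.mpr h0) (by
      intro h
      rw [inv_eq_one] at h
      linarith)
    rw [Real.log_inv, ← hL] at h
    rw [show (1 - η) / η = η⁻¹ - 1 by field_simp]
    exact h
  have hlo : 2 * (1 - η) / (1 + η) < L := by
    have hx : 0 < 1 / η - 1 := by
      rw [show 1 / η - 1 = (1 - η) / η by field_simp]
      positivity
    have h := Real.lt_log_one_add_of_pos hx
    rw [hLinv] at h
    have e : 2 * (1 / η - 1) / (1 / η - 1 + 2) = 2 * (1 - η) / (1 + η) := by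
      rw [show 1 / η - 1 = (1 - η) / η by field_simp,
        show (1 - η) / η + 2 = (1 + η) / η by field_simp; ring]
      field_simp
    rwa [e] at h
  have hs : ρstar = 1 / L - η / (1 - η) := by
    rw [hρstar, hlog, neg_div_neg_eq]
  rw [lt_div_iff₀ h0] at hup
  rw [div_lt_iff₀ (by linarith)] at hlo
  have hd : ∀ ρ, HasDerivAt (fun ρ => chiL ρ η)
      (η ^ (ρ - 1) * ((1 - η) * L) * (ρstar - ρ)) ρ := by
    intro ρ
    have a := ((hasDerivAt_id ρ).sub_const 1).const_rpow h0
    have b := ((hasDerivAt_id ρ).const_mul (1 - η)).const_add η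
    have c := a.mul b
    refine c.congr_deriv ?_
    simp only [id]
    rw [hlog, hs]
    field_simp
    ring
  have hpos : ∀ ρ : ℝ, 0 < η ^ (ρ - 1) * ((1 - η) * L) := fun ρ =>
    mul_pos (Real.rpow_pos_of_pos h0 _) (mul_pos h1' hL0)
  have hc : Continuous (fun ρ => chiL ρ η) :=
    continuous_iff_continuousAt.mpr fun ρ => (hd ρ).continuousAt
  refine ⟨⟨?_, ?_⟩, ?_, ?_⟩
  · rw [hs, sub_pos, div_lt_div_iff₀ h1' hL0]
    linarith
  · rw [hs, sub_lt_iff_lt_add, show 1 / 2 + η / (1 - η) = (1 + η) / (2 * (1 - η)) by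
      field_simp; ring, div_lt_div_iff₀ hL0 (by linarith)]
    linarith
  · refine strictMonoOn_of_deriv_pos (convex_Icc _ _) hc.continuousOn ?_
    intro x hx
    rw [interior_Icc] at hx
    rw [(hd x).deriv]
    exact mul_pos (hpos x) (by linarith [hx.2])
  · refine strictAntiOn_of_deriv_neg (convex_Icc _ _) hc.continuousOn ?_
    intro x hx
    rw [interior_Icc] at hx
    rw [(hd x).deriv]
    exact mul_neg_of_pos_of_neg (hpos x) (by linarith [hx.1])
end

section
/- Let η ∈ (0,1) satisfy 2 − 2η + ln η ≥ 0. Then for every ρ ∈ [0,1] the second derivative of ρ ↦ χ_L(ρ,η) equals η^(ρ−1)·(ln η)·(2 − 2η + (ln η)·(η + (1−η)·ρ)) and is ≤ 0; consequently the map ρ ↦ χ_L(ρ,η) is concave on [0,1]. -/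
theorem chiL_second_deriv_nonpos_concave (η : ℝ) (hη : η ∈ Set.Ioo (0 : ℝ) 1)
    (hcond : 2 - 2 * η + Real.log η ≥ 0) :
    (∀ ρ ∈ Set.Icc (0 : ℝ) 1,
      deriv (deriv (fun ρ => chiL ρ η)) ρ
        = η ^ (ρ - 1) * Real.log η * (2 - 2 * η + Real.log η * (η + (1 - η) * ρ)) ∧
      η ^ (ρ - 1) * Real.log η * (2 - 2 * η + Real.log η * (η + (1 - η) * ρ)) ≤ 0) ∧
    ConcaveOn ℝ (Set.Icc (0 : ℝ) 1) (fun ρ => chiL ρ η) := by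
  obtain ⟨h0, h1⟩ := hη
  have hL : Real.log η < 0 := Real.log_neg h0 h1
  have hp : ∀ ρ : ℝ, HasDerivAt (fun ρ : ℝ => η ^ (ρ - 1)) (η ^ (ρ - 1) * Real.log η) ρ := by
    intro ρ
    have h := ((hasDerivAt_id ρ).sub_const 1).const_rpow h0
    exact h.congr_deriv (by simp only [id]; ring)
  have hl : ∀ ρ : ℝ, HasDerivAt (fun ρ : ℝ => η + (1 - η) * ρ) (1 - η) ρ := by
    intro ρ
    have h := ((hasDerivAt_id ρ).const_mul (1 - η)).const_add η
    exact h.congr_deriv (by ring)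
  have hd1 : deriv (fun ρ => chiL ρ η) = fun ρ =>
      η ^ (ρ - 1) * Real.log η * (η + (1 - η) * ρ) + η ^ (ρ - 1) * (1 - η) := by
    funext ρ
    exact ((hp ρ).mul (hl ρ)).deriv
  have hd2 : ∀ ρ : ℝ, deriv (deriv (fun ρ => chiL ρ η)) ρ
        = η ^ (ρ - 1) * Real.log η * (2 - 2 * η + Real.log η * (η + (1 - η) * ρ)) := by
    intro ρ
    rw [hd1]
    have h := ((((hp ρ).mul_const (Real.log η)).mul (hl ρ)).add ((hp ρ).mul_const (1 - η))).deriv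
    refine Eq.trans h ?_
    ring
  have hn : ∀ ρ ∈ Set.Icc (0 : ℝ) 1,
      η ^ (ρ - 1) * Real.log η * (2 - 2 * η + Real.log η * (η + (1 - η) * ρ)) ≤ 0 := by
    rintro ρ ⟨_, hr⟩
    have hpos : 0 < η ^ (ρ - 1) := Real.rpow_pos_of_pos h0 _
    have ht : η + (1 - η) * ρ ≤ 1 := by nlinarith
    apply mul_nonpos_of_nonpos_of_nonneg
    · exact (mul_neg_of_pos_of_neg hpos hL).le
    · nlinarith
  refine ⟨fun ρ hρ => ⟨hd2 ρ, hn ρ hρ⟩, ?_⟩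
  have hdiff : Differentiable ℝ (fun ρ => chiL ρ η) := fun ρ =>
    ((hp ρ).mul (hl ρ)).differentiableAt
  apply concaveOn_of_deriv2_nonpos (convex_Icc 0 1) hdiff.continuous.continuousOn
    hdiff.differentiableOn
  · rw [hd1]
    intro ρ _
    exact ((((hp ρ).mul_const (Real.log η)).mul (hl ρ)).add
      ((hp ρ).mul_const (1 - η))).differentiableAt.differentiableWithinAt
  · intro ρ hρ
    change deriv (deriv (fun ρ => chiL ρ η)) ρ ≤ 0
    rw [hd2]
    exact hn ρ (interior_subset hρ)
end

section
/- The function ρ*: (0,1) → ℝ given by ρ*(η) = −1/ln η − η/(1−η) is differentiable on (0,1), its derivative at every η ∈ (0,1) equals (η^(−1/2) − η^(1/2) + ln η)·(η^(−1/2) − η^(1/2) − ln η) / ((1−η)·ln η)², and this derivative is strictly positive; hence ρ* is strictly increasing on (0,1). -/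
/-- The optimal angle-domain sparsity level ρ*(η) = −1/ln η − η/(1−η). -/
noncomputable def rhoStar (η : ℝ) : ℝ := -1 / Real.log η - η / (1 - η)

theorem rhoStar_deriv_pos_strictMono :
    (∀ η ∈ Set.Ioo (0 : ℝ) 1,
      HasDerivAt rhoStar
        ((η ^ (-(1 / 2) : ℝ) - η ^ ((1 / 2) : ℝ) + Real.log η)
          * (η ^ (-(1 / 2) : ℝ) - η ^ ((1 / 2) : ℝ) - Real.log η)
          / ((1 - η) * Real.log η) ^ 2) η ∧
      0 < (η ^ (-(1 / 2) : ℝ) - η ^ ((1 / 2) : ℝ) + Real.log η)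
          * (η ^ (-(1 / 2) : ℝ) - η ^ ((1 / 2) : ℝ) - Real.log η)
          / ((1 - η) * Real.log η) ^ 2) ∧
    StrictMonoOn rhoStar (Set.Ioo (0 : ℝ) 1) := by
  have key : ∀ η ∈ Set.Ioo (0 : ℝ) 1,
      HasDerivAt rhoStar
        ((η ^ (-(1 / 2) : ℝ) - η ^ ((1 / 2) : ℝ) + Real.log η)
          * (η ^ (-(1 / 2) : ℝ) - η ^ ((1 / 2) : ℝ) - Real.log η)
          / ((1 - η) * Real.log η) ^ 2) η ∧
      0 < (η ^ (-(1 / 2) : ℝ) - η ^ ((1 / 2) : ℝ) + Real.log η)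
          * (η ^ (-(1 / 2) : ℝ) - η ^ ((1 / 2) : ℝ) - Real.log η)
          / ((1 - η) * Real.log η) ^ 2 := by
    rintro η ⟨h0, h1⟩
    have hL : Real.log η < 0 := Real.log_neg h0 h1
    have hL0 : Real.log η ≠ 0 := hL.ne
    have h1' : (1 - η) ≠ 0 := by linarith
    have hη : η ≠ 0 := h0.ne'
    constructor
    · have hd : HasDerivAt rhoStar
          ((0 * Real.log η - (-1) * η⁻¹) / Real.log η ^ 2
            - (1 * (1 - η) - η * (-1)) / (1 - η) ^ 2) η :=
        ((hasDerivAt_const η (-1 : ℝ)).div (Real.hasDerivAt_log hη) hL0).sub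
          ((hasDerivAt_id η).div ((hasDerivAt_id η).const_sub 1) h1')
      convert hd using 1
      have hs : 0 < η ^ ((1 / 2) : ℝ) := Real.rpow_pos_of_pos h0 _
      have hs2 : η ^ ((1 / 2) : ℝ) * η ^ ((1 / 2) : ℝ) = η := by
        rw [← Real.rpow_add h0]; norm_num
      rw [Real.rpow_neg h0.le]
      generalize η ^ ((1 / 2) : ℝ) = s at hs hs2
      generalize Real.log η = L at hL hL0
      subst hs2
      have hs' : s ≠ 0 := hs.ne'
      have h1s : 1 - s ^ 2 ≠ 0 := by rw [pow_two]; exact h1'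
      field_simp
      ring
    · have hsinh := Real.self_lt_sinh_iff.2 (show 0 < -(Real.log η) / 2 by linarith)
      rw [Real.sinh_eq] at hsinh
      have e1 : η ^ (-(1 / 2) : ℝ) = Real.exp (-(Real.log η) / 2) := by
        rw [Real.rpow_def_of_pos h0]; congr 1; ring
      have e2 : η ^ ((1 / 2) : ℝ) = Real.exp (-(-(Real.log η) / 2)) := by
        rw [Real.rpow_def_of_pos h0]; congr 1; ring
      rw [e1, e2]
      apply div_pos
      · apply mul_pos <;> linarith
      · positivity
  refine ⟨key, ?_⟩
  apply strictMonoOn_of_deriv_pos (convex_Ioo 0 1)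
  · exact fun x hx => (key x hx).1.continuousAt.continuousWithinAt
  · intro x hx
    rw [interior_Ioo] at hx
    rw [(key x hx).1.deriv]
    exact (key x hx).2
end

section
/- For every η ∈ (0,1), the quantity ρ*(η) = −1/ln η − η/(1−η) satisfies 0 < ρ*(η) < 1/2. -/
theorem rhoStar_mem_Ioo (η : ℝ) (hη : η ∈ Set.Ioo (0 : ℝ) 1) :
    0 < rhoStar η ∧ rhoStar η < 1 / 2 := by
  obtain ⟨h0, h1⟩ := hη
  have h1' : 0 < 1 - η := by linarith
  have hp : 0 < 1 + η := by linarith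
  have hA : Real.log η⁻¹ < η⁻¹ - 1 :=
    Real.log_lt_sub_one_of_pos (inv_pos.mpr h0) (by
      intro h
      rw [inv_eq_one] at h
      linarith)
  have hx : 0 < (1 - η) / (1 + η) := div_pos h1' hp
  have hB := Real.sum_range_le_log_div hx.le (by rw [div_lt_one hp]; linarith) 2
  have he : (1 + (1 - η) / (1 + η)) / (1 - (1 - η) / (1 + η)) = η⁻¹ := by
    have e1 : 1 + (1 - η) / (1 + η) = 2 / (1 + η) := by field_simp; ring
    have e2 : 1 - (1 - η) / (1 + η) = 2 * η / (1 + η) := by field_simp; ring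
    rw [e1, e2]
    field_simp
  rw [he] at hB
  simp only [Finset.sum_range_succ, Finset.sum_range_zero] at hB
  norm_num at hB
  rw [Real.log_inv] at hA
  have hx3 := pow_pos hx 3
  have hL : Real.log η < 0 := Real.log_neg h0 h1
  have hr : rhoStar η = 1 / (-Real.log η) - η / (1 - η) := by
    unfold rhoStar
    rw [div_neg, neg_div]
  rw [hr]
  generalize Real.log η = l at *
  have hl : 0 < -l := by linarith
  constructor
  · rw [sub_pos, div_lt_div_iff₀ h1' hl]
    have := mul_lt_mul_of_pos_left hA h0
    rw [mul_sub, mul_inv_cancel₀ h0.ne'] at this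
    linarith
  · have hC : 2 * ((1 - η) / (1 + η)) < -l := by linarith
    have e : 1 / 2 + η / (1 - η) = (1 + η) / (2 * (1 - η)) := by field_simp; ring
    rw [sub_lt_iff_lt_add, e, div_lt_div_iff₀ hl (by linarith)]
    rw [← mul_div_assoc, div_lt_iff₀ hp] at hC
    linarith
end

section
/- Fix ρ ∈ (0,1) and positive reals M_r, N_t with M_r < N_t·(1−ρ). The map η ↦ χ_H(ρ,η) is differentiable on (0,1), its derivative at every η ∈ (0,1) equals (ρ·(ρ−2) − η·(ρ−1)²)·η^(ρ−3)·(1 − M_r/(N_t·(1−ρ)))^(−1), and this derivative is strictly negative; hence η ↦ χ_H(ρ,η) is strictly decreasing on (0,1). -/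
/-- The high-SNR sparsity metric
χ_H(ρ,η) = η^(ρ−2)·(η + (1−η)·ρ)·(1 − M_r/(N_t·(1−ρ)))⁻¹. -/
noncomputable def chiH (Mr Nt ρ η : ℝ) : ℝ :=
  η ^ (ρ - 2) * (η + (1 - η) * ρ) * (1 - Mr / (Nt * (1 - ρ)))⁻¹

theorem chiH_strictAntiOn_in_eta (Mr Nt ρ : ℝ) (hMr : 0 < Mr) (hNt : 0 < Nt)
    (hρ : ρ ∈ Set.Ioo (0 : ℝ) 1) (h : Mr < Nt * (1 - ρ)) :
    (∀ η ∈ Set.Ioo (0 : ℝ) 1,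
      HasDerivAt (fun η => chiH Mr Nt ρ η)
        ((ρ * (ρ - 2) - η * (ρ - 1) ^ 2) * η ^ (ρ - 3) * (1 - Mr / (Nt * (1 - ρ)))⁻¹) η ∧
      (ρ * (ρ - 2) - η * (ρ - 1) ^ 2) * η ^ (ρ - 3) * (1 - Mr / (Nt * (1 - ρ)))⁻¹ < 0) ∧
    StrictAntiOn (fun η => chiH Mr Nt ρ η) (Set.Ioo (0 : ℝ) 1) := by
  obtain ⟨h0, h1⟩ := hρ
  have hpos : 0 < Nt * (1 - ρ) := mul_pos hNt (by linarith)
  have hc : 0 < (1 - Mr / (Nt * (1 - ρ)))⁻¹ := by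
    apply inv_pos.mpr
    have := (div_lt_one hpos).mpr h
    linarith
  have key : ∀ η ∈ Set.Ioo (0 : ℝ) 1,
      HasDerivAt (fun η => chiH Mr Nt ρ η)
        ((ρ * (ρ - 2) - η * (ρ - 1) ^ 2) * η ^ (ρ - 3) * (1 - Mr / (Nt * (1 - ρ)))⁻¹) η ∧
      (ρ * (ρ - 2) - η * (ρ - 1) ^ 2) * η ^ (ρ - 3) * (1 - Mr / (Nt * (1 - ρ)))⁻¹ < 0 := by
    rintro η ⟨hη, hη1⟩
    constructor
    · have d1 : HasDerivAt (fun x : ℝ => x ^ (ρ - 2)) ((ρ - 2) * η ^ (ρ - 2 - 1)) η :=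
        Real.hasDerivAt_rpow_const (Or.inl hη.ne')
      have d2 : HasDerivAt (fun x : ℝ => x + (1 - x) * ρ) (1 + (-1) * ρ) η :=
        (hasDerivAt_id η).add (((hasDerivAt_id η).const_sub 1).mul_const ρ)
      have d3 := (d1.mul d2).mul_const (1 - Mr / (Nt * (1 - ρ)))⁻¹
      have e1 : ρ - 2 - 1 = ρ - 3 := by ring
      have e2 : η ^ (ρ - 2) = η ^ (ρ - 3) * η := by
        rw [← Real.rpow_add_one hη.ne']
        congr 1
        ring
      refine HasDerivAt.congr_deriv d3 ?_
      rw [e1, e2]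
      ring
    · apply mul_neg_of_neg_of_pos _ hc
      apply mul_neg_of_neg_of_pos _ (Real.rpow_pos_of_pos hη _)
      have a1 : 0 < ρ * (2 - ρ) := mul_pos h0 (by linarith)
      have a2 : 0 ≤ η * (ρ - 1) ^ 2 := by positivity
      linarith
  refine ⟨key, ?_⟩
  apply strictAntiOn_of_deriv_neg (convex_Ioo 0 1)
  · intro x hx
    exact (key x hx).1.continuousAt.continuousWithinAt
  · intro x hx
    rw [interior_Ioo] at hx
    rw [(key x hx).1.deriv]
    exact (key x hx).2
end

section
/- For every η ∈ (0,1): χ_L(0,η) = 1, χ_L(1,η) = 1, and χ_L(ρ,η) > 1 for every ρ ∈ (0,1); i.e., the secrecy rate bonus log₂ χ_L(ρ,η) is strictly positive for all interior sparsity levels ρ and vanishes exactly at the endpoints ρ = 0 and ρ = 1. -/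
theorem chiL_endpoints_and_interior (η : ℝ) (hη : η ∈ Set.Ioo (0 : ℝ) 1) :
    chiL 0 η = 1 ∧ chiL 1 η = 1 ∧ ∀ ρ ∈ Set.Ioo (0 : ℝ) 1, 1 < chiL ρ η := by
  obtain ⟨h0, h1⟩ := hη
  refine ⟨?_, ?_, ?_⟩
  · unfold chiL
    rw [zero_sub, Real.rpow_neg_one, mul_zero, add_zero, inv_mul_cancel₀ h0.ne']
  · simp [chiL]
  · rintro ρ ⟨r0, r1⟩
    have hb := rpow_one_add_lt_one_add_mul_self (s := η - 1) (by linarith) (sub_ne_zero.mpr h1.ne)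
      (p := 1 - ρ) (by linarith) (by linarith)
    rw [add_sub_cancel] at hb
    have hp : 0 < η ^ (ρ - 1) := Real.rpow_pos_of_pos h0 _
    have he : η ^ (ρ - 1) * η ^ (1 - ρ) = 1 := by
      rw [← Real.rpow_add h0]
      simp
    unfold chiL
    calc (1 : ℝ) = η ^ (ρ - 1) * η ^ (1 - ρ) := he.symm
      _ < η ^ (ρ - 1) * (1 + (1 - ρ) * (η - 1)) := mul_lt_mul_of_pos_left hb hp
      _ = η ^ (ρ - 1) * (η + (1 - η) * ρ) := by ring
end

section
/- Let M_t, M_r, M_e, P, σ² be positive reals, φ ∈ (0,1), ρ ∈ (0,1], and η ∈ (0,1). Then M_t·max(0, log₂(1 + M_r·φ·P/(M_t·σ²)) − ρ·log₂(1 + φ·M_e/((1−φ)·M_t·(η + (1−η)·ρ))) − (1−ρ)·log₂(1 + φ·M_e·η/((1−φ)·M_t·(η + (1−η)·ρ)))) ≤ M_t·max(0, log₂(1 + M_r·φ·P/(M_t·σ²)) − log₂(φ·M_e/((1−φ)·M_t)) + log₂ χ_L(ρ,η)); i.e., the low-SNR ergodic achievable secrecy rate expression is upper bounded by the bound R̄_S^L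 of Theorem 2, in which the channel sparsity contributes the additive secrecy rate bonus M_t·log₂ χ_L(ρ,η). -/
theorem low_snr_secrecy_rate_upper_bound (Mt Mr Me P σ2 φ ρ η : ℝ)
    (hMt : 0 < Mt) (hMr : 0 < Mr) (hMe : 0 < Me) (hP : 0 < P) (hσ2 : 0 < σ2)
    (hφ : φ ∈ Set.Ioo (0 : ℝ) 1) (hρ : ρ ∈ Set.Ioc (0 : ℝ) 1) (hη : η ∈ Set.Ioo (0 : ℝ) 1) :
    Mt * max 0 (Real.logb 2 (1 + Mr * φ * P / (Mt * σ2))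
        - ρ * Real.logb 2 (1 + φ * Me / ((1 - φ) * Mt * (η + (1 - η) * ρ)))
        - (1 - ρ) * Real.logb 2 (1 + φ * Me * η / ((1 - φ) * Mt * (η + (1 - η) * ρ))))
    ≤ Mt * max 0 (Real.logb 2 (1 + Mr * φ * P / (Mt * σ2))
        - Real.logb 2 (φ * Me / ((1 - φ) * Mt))
        + Real.logb 2 (chiL ρ η)) := by
  obtain ⟨hφ0, hφ1⟩ := hφ
  obtain ⟨hρ0, hρ1⟩ := hρ
  obtain ⟨hη0, hη1⟩ := hη
  have hD : 0 < η + (1 - η) * ρ := by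
    have := mul_pos (sub_pos.2 hη1) hρ0
    linarith
  have hφ' : 0 < 1 - φ := sub_pos.2 hφ1
  have hA : 0 < φ * Me / ((1 - φ) * Mt) := by positivity
  have hchi : Real.logb 2 (chiL ρ η)
      = (ρ - 1) * Real.logb 2 η + Real.logb 2 (η + (1 - η) * ρ) := by
    unfold chiL
    rw [Real.logb_mul (by positivity) hD.ne', Real.logb_rpow_eq_mul_logb_of_pos hη0]
  rw [hchi]
  generalize η + (1 - η) * ρ = D at hD ⊢
  have e1 : φ * Me / ((1 - φ) * Mt * D) = φ * Me / ((1 - φ) * Mt) / D := by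
    field_simp
  have e2 : φ * Me * η / ((1 - φ) * Mt * D) = φ * Me / ((1 - φ) * Mt) * η / D := by
    field_simp
  rw [e1, e2]
  generalize φ * Me / ((1 - φ) * Mt) = A at hA ⊢
  have h1 : Real.logb 2 A - Real.logb 2 D ≤ Real.logb 2 (1 + A / D) := by
    rw [← Real.logb_div hA.ne' hD.ne']
    exact Real.logb_le_logb_of_le (by norm_num) (by positivity) (by linarith)
  have h2 : Real.logb 2 A + Real.logb 2 η - Real.logb 2 D ≤ Real.logb 2 (1 + A * η / D) := by
    rw [← Real.logb_mul hA.ne' hη0.ne', ← Real.logb_div (by positivity) hD.ne']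
    exact Real.logb_le_logb_of_le (by norm_num) (by positivity) (by linarith)
  have h3 := mul_le_mul_of_nonneg_left h1 hρ0.le
  have h4 := mul_le_mul_of_nonneg_left h2 (sub_nonneg.2 hρ1)
  apply mul_le_mul_of_nonneg_left _ hMt.le
  apply max_le_max le_rfl
  linarith
end

section
/- Let M_t, M_r, M_e, N_t be positive reals, φ ∈ (0,1), η ∈ (0,1), and ρ ∈ (0,1) with M_r < N_t·(1−ρ). Set A = M_r·φ/(M_t·(1−φ)·η·(1 − M_r/(N_t·(1−ρ)))). Then M_t·max(0, log₂(1 + A) − ρ·log₂(1 + φ·M_e/((1−φ)·M_t·(η + (1−η)·ρ))) − (1−ρ)·log₂(1 + φ·M_e·η/((1−φ)·M_t·(η + (1−η)·ρ)))) ≤ M_t·max(0, log₂(1 + A) − log₂(φ·M_e/((1−φ)·M_t)) + log₂ χ_L(ρ,η)); i.e., the high-SNR ergodic achievable secrecy rate expression is upper bounded by the bound derived in Theorem 2, in which the channel sparsity contributes the additive secrecy rate bonus M_t·log₂ χ_L(ρ,η). -/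
theorem high_snr_secrecy_rate_upper_bound (Mt Mr Me Nt φ η ρ : ℝ)
    (hMt : 0 < Mt) (hMr : 0 < Mr) (hMe : 0 < Me) (hNt : 0 < Nt)
    (hφ : φ ∈ Set.Ioo (0 : ℝ) 1) (hη : η ∈ Set.Ioo (0 : ℝ) 1)
    (hρ : ρ ∈ Set.Ioo (0 : ℝ) 1) (h : Mr < Nt * (1 - ρ))
    (A : ℝ) (hA : A = Mr * φ / (Mt * (1 - φ) * η * (1 - Mr / (Nt * (1 - ρ))))) :
    Mt * max 0 (Real.logb 2 (1 + A)
        - ρ * Real.logb 2 (1 + φ * Me / ((1 - φ) * Mt * (η + (1 - η) * ρ)))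
        - (1 - ρ) * Real.logb 2 (1 + φ * Me * η / ((1 - φ) * Mt * (η + (1 - η) * ρ))))
    ≤ Mt * max 0 (Real.logb 2 (1 + A)
        - Real.logb 2 (φ * Me / ((1 - φ) * Mt))
        + Real.logb 2 (chiL ρ η)) := by
  obtain ⟨hφ0, hφ1⟩ := hφ
  obtain ⟨hη0, hη1⟩ := hη
  obtain ⟨hρ0, hρ1⟩ := hρ
  have h1φ : 0 < 1 - φ := by linarith
  have hs : 0 < η + (1 - η) * ρ := by
    have := mul_pos (sub_pos.mpr hη1) hρ0
    linarith
  have hx : 0 < φ * Me / ((1 - φ) * Mt) := by positivity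
  have e1 : φ * Me / ((1 - φ) * Mt * (η + (1 - η) * ρ))
      = (φ * Me / ((1 - φ) * Mt)) / (η + (1 - η) * ρ) := by rw [div_div]
  have e2 : φ * Me * η / ((1 - φ) * Mt * (η + (1 - η) * ρ))
      = (φ * Me / ((1 - φ) * Mt)) * η / (η + (1 - η) * ρ) := by
    field_simp
  rw [e1, e2]
  unfold chiL
  generalize φ * Me / ((1 - φ) * Mt) = x at *
  generalize η + (1 - η) * ρ = s at *
  have l1 : Real.logb 2 x - Real.logb 2 s ≤ Real.logb 2 (1 + x / s) := by
    rw [← Real.logb_div hx.ne' hs.ne']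
    exact Real.logb_le_logb_of_le (by norm_num) (by positivity) (by linarith)
  have l2 : Real.logb 2 x + Real.logb 2 η - Real.logb 2 s
      ≤ Real.logb 2 (1 + x * η / s) := by
    rw [← Real.logb_mul hx.ne' hη0.ne', ← Real.logb_div (by positivity) hs.ne']
    exact Real.logb_le_logb_of_le (by norm_num) (by positivity) (by linarith)
  have l3 : Real.logb 2 (η ^ (ρ - 1) * s) = (ρ - 1) * Real.logb 2 η + Real.logb 2 s := by
    rw [Real.logb_mul (Real.rpow_pos_of_pos hη0 _).ne' hs.ne',
      Real.logb_rpow_eq_mul_logb_of_pos hη0]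
  rw [l3]
  have m1 := mul_le_mul_of_nonneg_left l1 hρ0.le
  have m2 := mul_le_mul_of_nonneg_left l2 (sub_pos.mpr hρ1).le
  apply mul_le_mul_of_nonneg_left _ hMt.le
  apply max_le_max le_rfl
  linarith
end
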